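/- arXiv:1401.4847 — 3 statements merged into one kernel-verified Lean document; each statement's English description precedes it below -/
import Mathlib

section
/- Let V ∈ C²(ℝⁿ, ℝ) be convex. Then r ↦ (1/r^{n−1}) ∫_{B(x,r)} ΔV dy is a nondecreasing function of r > 0. -/
open MeasureTheory Filter Topology

/-- Integration by parts for the divergence of a `C¹` covector field against a test function. -/
theorem integral_mul_divergence_eq_neg {n : ℕ}
    {A : EuclideanSpace ℝ (Fin n) → (EuclideanSpace ℝ (Fin n) →L[ℝ] ℝ)} (hA : ContDiff ℝ 1 A)
    {φ : EuclideanSpace ℝ (Fin n) → ℝ} (hφ : ContDiff ℝ 1 φ) (hφc : HasCompactSupport φ) :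
    ∫ z, φ z * ∑ i : Fin n, fderiv ℝ A z (EuclideanSpace.single i 1) (EuclideanSpace.single i 1) =
      -∫ z, ∑ i : Fin n,
        fderiv ℝ φ z (EuclideanSpace.single i 1) * A z (EuclideanSpace.single i 1) := by
  have hA' : Continuous (fderiv ℝ A) := hA.continuous_fderiv one_ne_zero
  have hφ' : Continuous (fderiv ℝ φ) := hφ.continuous_fderiv one_ne_zero
  have hA0 := hA.continuous
  have hφ0 := hφ.continuous
  have hdiff (z : EuclideanSpace ℝ (Fin n)) : DifferentiableAt ℝ A z :=
    hA.differentiable one_ne_zero z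
  have hint (v : EuclideanSpace ℝ (Fin n)) : Integrable fun z ↦ φ z * fderiv ℝ A z v v :=
    Continuous.integrable_of_hasCompactSupport (by fun_prop) hφc.mul_right
  have hint' (v : EuclideanSpace ℝ (Fin n)) : Integrable fun z ↦ fderiv ℝ φ z v * A z v :=
    Continuous.integrable_of_hasCompactSupport (by fun_prop) (hφc.fderiv_apply ℝ v).mul_right
  have happ (v z : EuclideanSpace ℝ (Fin n)) :
      fderiv ℝ (fun y ↦ A y v) z v = fderiv ℝ A z v v := by
    rw [fderiv_clm_apply (hdiff z) (differentiableAt_const v)]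
    simp
  simp_rw [Finset.mul_sum]
  rw [integral_finsetSum _ fun i _ ↦ hint _, integral_finsetSum _ fun i _ ↦ hint' _,
    ← Finset.sum_neg_distrib]
  refine Finset.sum_congr rfl fun i _ ↦ ?_
  set v : EuclideanSpace ℝ (Fin n) := EuclideanSpace.single i 1
  have := integral_mul_fderiv_eq_neg_fderiv_mul_of_integrable (μ := volume) (f := φ)
    (g := fun y ↦ A y v) (v := v) (hint' v) (by simpa only [happ] using hint v)
    (Continuous.integrable_of_hasCompactSupport (by fun_prop) hφc.mul_right)
    (fun z _ ↦ hφ.differentiable one_ne_zero z)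
    (fun z _ ↦ (hdiff z).clm_apply (differentiableAt_const v))
  simpa only [happ] using this

/-- The smooth radial cutoffs used to approximate the indicator of the unit ball. -/
noncomputable def radialCutoff (E : Type*) [NormedAddCommGroup E] (k : ℝ) (z : E) : ℝ :=
  Real.smoothTransition (k * (1 - ‖z‖ ^ 2))

theorem radialCutoff_eq_zero {E : Type*} [NormedAddCommGroup E] {k : ℝ} (hk : 0 ≤ k) {z : E}
    (hz : z ∉ Metric.ball 0 1) : radialCutoff E k z = 0 := by
  refine Real.smoothTransition.zero_of_nonpos (mul_nonpos_of_nonneg_of_nonpos hk ?_)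
  simp only [mem_ball_zero_iff, not_lt] at hz
  nlinarith

theorem contDiff_radialCutoff {E : Type*} [NormedAddCommGroup E] [InnerProductSpace ℝ E] (k : ℝ) :
    ContDiff ℝ 1 (radialCutoff E k) :=
  (Real.smoothTransition.contDiff (n := 1)).comp
    (contDiff_const.mul (contDiff_const.sub (contDiff_norm_sq ℝ)))

theorem fderiv_radialCutoff {E : Type*} [NormedAddCommGroup E] [InnerProductSpace ℝ E]
    (k : ℝ) (z v : E) :
    fderiv ℝ (radialCutoff E k) z v =
      -(2 * k * deriv Real.smoothTransition (k * (1 - ‖z‖ ^ 2))) * inner ℝ z v := by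
  have h : HasFDerivAt (radialCutoff E k) _ z :=
    ((Real.smoothTransition.contDiff (n := 1)).differentiable
      one_ne_zero _).hasDerivAt.comp_hasFDerivAt z (((hasStrictFDerivAt_norm_sq z).hasFDerivAt.const_sub 1).const_mul k)
  rw [h.fderiv]
  simp
  ring

/-- The divergence of a covector field that is nonnegative in the radial direction has nonnegative
integral over the unit ball. -/
theorem setIntegral_ball_divergence_nonneg {n : ℕ}
    {A : EuclideanSpace ℝ (Fin n) → (EuclideanSpace ℝ (Fin n) →L[ℝ] ℝ)} (hA : ContDiff ℝ 1 A)
    (hA_radial : ∀ z, 0 ≤ A z z) :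
    0 ≤ ∫ z in Metric.ball 0 1,
      ∑ i : Fin n, fderiv ℝ A z (EuclideanSpace.single i 1) (EuclideanSpace.single i 1) := by
  have hA' : Continuous (fderiv ℝ A) := hA.continuous_fderiv one_ne_zero
  set D : EuclideanSpace ℝ (Fin n) → ℝ := fun z ↦
    ∑ i : Fin n, fderiv ℝ A z (EuclideanSpace.single i 1) (EuclideanSpace.single i 1)
  have hDc : Continuous D := by fun_prop
  have hDint : IntegrableOn D (Metric.ball 0 1) :=
    (hDc.continuousOn.integrableOn_compact (isCompact_closedBall 0 1)).mono_set
      Metric.ball_subset_closedBall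
  have hnonneg (k : ℕ) : 0 ≤ ∫ z in Metric.ball 0 1, radialCutoff _ (k : ℝ) z * D z := by
    have hsupp : Function.support (radialCutoff (EuclideanSpace ℝ (Fin n)) k) ⊆
        Metric.ball 0 1 := fun z hz ↦ by
      by_contra h
      exact hz (radialCutoff_eq_zero k.cast_nonneg h)
    rw [setIntegral_eq_integral_of_forall_compl_eq_zero fun z hz ↦ by
        rw [radialCutoff_eq_zero k.cast_nonneg hz, zero_mul],
      integral_mul_divergence_eq_neg hA (contDiff_radialCutoff _)
        (HasCompactSupport.of_support_subset_isCompact (isCompact_closedBall 0 1)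
          (hsupp.trans Metric.ball_subset_closedBall)), ← integral_neg]
    refine integral_nonneg fun z ↦ ?_
    have hz : A z z = ∑ i : Fin n, z i * A z (EuclideanSpace.single i 1) := by
      conv_lhs => enter [2]; rw [← (EuclideanSpace.basisFun (Fin n) ℝ).sum_repr z]
      simp
    have hderiv : 0 ≤ deriv Real.smoothTransition (k * (1 - ‖z‖ ^ 2)) :=
      Real.smoothTransition.monotone.deriv_nonneg
    have heq : -∑ i : Fin n, fderiv ℝ (radialCutoff _ (k : ℝ)) z (EuclideanSpace.single i 1) *
        A z (EuclideanSpace.single i 1) =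
        2 * k * deriv Real.smoothTransition (k * (1 - ‖z‖ ^ 2)) * A z z := by
      rw [hz, Finset.mul_sum, ← Finset.sum_neg_distrib]
      refine Finset.sum_congr rfl fun i _ ↦ ?_
      rw [fderiv_radialCutoff, EuclideanSpace.inner_single_right]
      simp
      ring
    simp only [Pi.zero_apply, heq]
    have := hA_radial z
    positivity
  refine ge_of_tendsto' (tendsto_integral_of_dominated_convergence (fun z ↦ ‖D z‖)
    (fun k ↦ ((contDiff_radialCutoff (k : ℝ)).continuous.mul hDc).aestronglyMeasurable)
    hDint.norm (fun k ↦ ae_of_all _ fun z ↦ ?_) ?_) hnonneg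
  · rw [Pi.mul_apply, norm_mul, radialCutoff, Real.norm_of_nonneg (Real.smoothTransition.nonneg _)]
    exact mul_le_of_le_one_left (norm_nonneg _) (Real.smoothTransition.le_one _)
  · filter_upwards [ae_restrict_mem measurableSet_ball] with z hz
    have hpos : 0 < 1 - ‖z‖ ^ 2 := by
      have := norm_nonneg z
      rw [mem_ball_zero_iff] at hz
      nlinarith
    refine tendsto_const_nhds.congr' ?_
    filter_upwards [(tendsto_natCast_atTop_atTop.atTop_mul_const hpos).eventually_ge_atTop 1]
      with k hk
    rw [Pi.mul_apply, radialCutoff, Real.smoothTransition.one_of_one_le hk, one_mul]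

/-- The derivative of a convex function is monotone along lines. -/
theorem ConvexOn.fderiv_apply_mono {E : Type*} [NormedAddCommGroup E] [NormedSpace ℝ E]
    {V : E → ℝ} (hconv : ConvexOn ℝ Set.univ V) (hV : Differentiable ℝ V) (x z : E) :
    Monotone fun r : ℝ ↦ fderiv ℝ V (x + r • z) z := by
  have hderiv (r : ℝ) :
      HasDerivAt (fun t : ℝ ↦ V (x + t • z)) (fderiv ℝ V (x + r • z) z) r := by
    have h : HasDerivAt (fun t : ℝ ↦ x + t • z) z r := by
      simpa using ((hasDerivAt_id r).smul_const z).const_add x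
    exact (hV _).hasFDerivAt.comp_hasDerivAt r h
  have hc : ConvexOn ℝ Set.univ fun t : ℝ ↦ V (x + t • z) := by
    refine ⟨convex_univ, fun s _ t _ a b ha hb hab ↦ ?_⟩
    convert hconv.2 (Set.mem_univ (x + s • z)) (Set.mem_univ (x + t • z)) ha hb hab using 2
    have hx : x = a • x + b • x := by rw [← add_smul, hab, one_smul]
    nth_rewrite 1 [hx]
    simp only [smul_eq_mul]
    module
  have := hc.monotoneOn_deriv fun r _ ↦ (hderiv r).differentiableAt
  rw [monotoneOn_univ] at this
  rwa [funext fun r ↦ (hderiv r).deriv] at this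

/-- Rescaling an integral over a ball to the unit ball. -/
theorem setIntegral_ball_eq_pow_mul {n : ℕ} (f : EuclideanSpace ℝ (Fin n) → ℝ)
    (x : EuclideanSpace ℝ (Fin n)) {r : ℝ} (hr : 0 < r) :
    ∫ y in Metric.ball x r, f y = r ^ n * ∫ z in Metric.ball 0 1, f (x + r • z) := by
  have h := Measure.setIntegral_comp_smul_of_pos volume (fun z ↦ f (x + z))
    (Metric.ball (0 : EuclideanSpace ℝ (Fin n)) 1) hr
  rw [h, finrank_euclideanSpace_fin, smul_unitBall_of_pos hr, smul_eq_mul,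
    mul_inv_cancel_left₀ (by positivity)]
  rw [← (measurePreserving_add_left volume x).setIntegral_preimage_emb
    (measurableEmbedding_addLeft x)]
  congr 2
  ext z
  simp [dist_eq_norm]

/-- Let `V ∈ C²(ℝⁿ, ℝ)` be convex. Then
`r ↦ (1/r^{n−1}) ∫_{B(x,r)} ΔV dy` is a nondecreasing function of `r > 0`. -/
theorem laplacian_average_monotone (n : ℕ) (V : EuclideanSpace ℝ (Fin n) → ℝ)
    (hV : ContDiff ℝ 2 V) (hconv : ConvexOn ℝ Set.univ V)
    (x : EuclideanSpace ℝ (Fin n)) :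
    ∀ r₁ r₂ : ℝ, 0 < r₁ → r₁ ≤ r₂ →
      (1 / r₁ ^ (n - 1)) * ∫ y in Metric.ball x r₁,
          ∑ i : Fin n, iteratedFDeriv ℝ 2 V y
            ![EuclideanSpace.single i (1 : ℝ), EuclideanSpace.single i (1 : ℝ)] ≤
        (1 / r₂ ^ (n - 1)) * ∫ y in Metric.ball x r₂,
          ∑ i : Fin n, iteratedFDeriv ℝ 2 V y
            ![EuclideanSpace.single i (1 : ℝ), EuclideanSpace.single i (1 : ℝ)] := by
  intro r₁ r₂ hr₁ hr
  obtain _ | m := n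
  · simp
  have hr₂ := hr₁.trans_le hr
  have hdV : ContDiff ℝ 1 (fderiv ℝ V) := hV.fderiv_right (by norm_num)
  have hresc (r : ℝ) : ContDiff ℝ 1 fun z ↦ fderiv ℝ V (x + r • z) :=
    hdV.comp (contDiff_const.add (contDiff_const_smul r))
  have hderiv (r : ℝ) (z v : EuclideanSpace ℝ (Fin (m + 1))) :
      fderiv ℝ (fun z ↦ fderiv ℝ V (x + r • z)) z v v =
        r * iteratedFDeriv ℝ 2 V (x + r • z) ![v, v] := by
    have h : HasFDerivAt (fun z : EuclideanSpace ℝ (Fin (m + 1)) ↦ x + r • z)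
        (r • ContinuousLinearMap.id ℝ _) z :=
      ((hasFDerivAt_id z).const_smul r).const_add x
    have hcomp : HasFDerivAt (fun z ↦ fderiv ℝ V (x + r • z)) _ z :=
      (hdV.differentiable one_ne_zero _).hasFDerivAt.comp z h
    rw [hcomp.fderiv, iteratedFDeriv_two_apply]
    simp
  have hdiv (r : ℝ) (hr : 0 < r) :
      (1 / r ^ (m + 1 - 1)) * ∫ y in Metric.ball x r,
          ∑ i : Fin (m + 1), iteratedFDeriv ℝ 2 V y
            ![EuclideanSpace.single i (1 : ℝ), EuclideanSpace.single i (1 : ℝ)] =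
        ∫ z in Metric.ball 0 1, ∑ i : Fin (m + 1), fderiv ℝ (fun z ↦ fderiv ℝ V (x + r • z)) z
          (EuclideanSpace.single i 1) (EuclideanSpace.single i 1) := by
    simp_rw [hderiv, ← Finset.mul_sum]
    rw [integral_const_mul, setIntegral_ball_eq_pow_mul _ x hr, Nat.add_sub_cancel]
    field_simp
    ring
  have hint (r : ℝ) : IntegrableOn (fun z ↦ ∑ i : Fin (m + 1),
      fderiv ℝ (fun z ↦ fderiv ℝ V (x + r • z)) z
        (EuclideanSpace.single i 1) (EuclideanSpace.single i 1)) (Metric.ball 0 1) := by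
    have := (hresc r).continuous_fderiv one_ne_zero
    exact (ContinuousOn.integrableOn_compact (isCompact_closedBall 0 1) (by fun_prop)).mono_set
      Metric.ball_subset_closedBall
  rw [hdiv r₁ hr₁, hdiv r₂ hr₂, ← sub_nonneg, ← integral_sub (hint r₂) (hint r₁)]
  convert setIntegral_ball_divergence_nonneg ((hresc r₂).sub (hresc r₁)) fun z ↦ ?_ using 3 with z
  · rw [← Finset.sum_sub_distrib]
    refine Finset.sum_congr rfl fun i _ ↦ ?_
    rw [fderiv_fun_sub ((hresc r₂).differentiable one_ne_zero z)
      ((hresc r₁).differentiable one_ne_zero z)]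
    rfl
  · simpa using hconv.fderiv_apply_mono (hV.differentiable two_ne_zero) x z hr
end

section
/- Let u : ℝⁿ → ℝ^m be a harmonic map (Δu = 0 componentwise) such that |u|² is convex. Then r ↦ (1/r^{n−1}) ∫_{B(x,r)} |∇u|² dy is nondecreasing in r > 0. -/
open MeasureTheory Filter Topology Metric in
/-- Rescaling of an average over a ball to the unit ball. -/
theorem one_div_pow_mul_setIntegral_ball {n : ℕ} (hn : n ≠ 0) (e : EuclideanSpace ℝ (Fin n) → ℝ)
    (x : EuclideanSpace ℝ (Fin n)) {r : ℝ} (hr : 0 < r) :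
    (1 / r ^ (n - 1)) * ∫ y in ball x r, e y = r * ∫ y in ball 0 1, e (x + r • y) := by
  have h1 := Measure.setIntegral_comp_smul_of_pos volume (fun z => e (x + z))
    (ball (0 : EuclideanSpace ℝ (Fin n)) 1) hr
  have h2 : ∫ z in ball (0 : EuclideanSpace ℝ (Fin n)) r, e (x + z) = ∫ y in ball x r, e y := by
    have := (measurePreserving_add_left volume x).setIntegral_preimage_emb
      (measurableEmbedding_addLeft x) e (ball x r)
    rwa [preimage_add_ball, sub_self] at this
  rw [smul_unitBall_of_pos hr, h2, finrank_euclideanSpace_fin, smul_eq_mul] at h1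
  rw [h1, ← mul_assoc]
  congr 1
  obtain ⟨k, rfl⟩ := Nat.exists_eq_succ_of_ne_zero hn
  simp only [Nat.succ_eq_add_one, Nat.add_sub_cancel]
  field_simp
  ring

section InnerFDeriv

variable {E F : Type*} [NormedAddCommGroup E] [NormedSpace ℝ E]
  [NormedAddCommGroup F] [InnerProductSpace ℝ F] {u : E → F}

theorem contDiff_inner_fderiv_apply (hu : ContDiff ℝ 2 u) (v : E) :
    ContDiff ℝ 1 fun y => inner ℝ (u y) (fderiv ℝ u y v) :=
  (hu.of_le one_le_two).inner ℝ ((hu.fderiv_right (m := 1) (by norm_num)).clm_apply contDiff_const)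

theorem fderiv_inner_fderiv_apply (hu : ContDiff ℝ 2 u) (y v : E) :
    fderiv ℝ (fun y => inner ℝ (u y) (fderiv ℝ u y v)) y v =
      ‖fderiv ℝ u y v‖ ^ 2 + inner ℝ (u y) (iteratedFDeriv ℝ 2 u y ![v, v]) := by
  have hd : DifferentiableAt ℝ u y := hu.differentiable two_ne_zero y
  have hd' : DifferentiableAt ℝ (fderiv ℝ u) y :=
    (hu.fderiv_right (m := 1) (by norm_num)).differentiable one_ne_zero y
  have h2 : HasFDerivAt (fun y => fderiv ℝ u y v) _ y :=
    hd'.hasFDerivAt.clm_apply (hasFDerivAt_const v y)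
  rw [(hd.hasFDerivAt.inner ℝ h2).fderiv, iteratedFDeriv_two_apply]
  simp [fderivInnerCLM_apply, add_comm]

theorem fderiv_comp_const_add_smul {w : E → ℝ} (hw : Differentiable ℝ w) (x y v : E) (r : ℝ) :
    fderiv ℝ (fun y => w (x + r • y)) y v = r * fderiv ℝ w (x + r • y) v := by
  have h : HasFDerivAt (fun y : E => x + r • y) (r • ContinuousLinearMap.id ℝ E) y :=
    ((hasFDerivAt_id y).const_smul r).const_add x
  have : HasFDerivAt (fun y => w (x + r • y)) _ y := (hw (x + r • y)).hasFDerivAt.comp y h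
  rw [this.fderiv]
  simp

/-- Along rays, half the derivative of a convex `‖u‖ ^ 2` is monotone. -/
theorem monotone_inner_fderiv_ray (hu : Differentiable ℝ u)
    (hconv : ConvexOn ℝ Set.univ fun x => ‖u x‖ ^ 2) (x y : E) :
    Monotone fun t : ℝ => inner ℝ (u (x + t • y)) (fderiv ℝ u (x + t • y) y) := by
  have hd (t : ℝ) : HasDerivAt (fun t : ℝ => ‖u (x + t • y)‖ ^ 2)
      (2 * inner ℝ (u (x + t • y)) (fderiv ℝ u (x + t • y) y)) t := by
    have h : HasDerivAt (fun t : ℝ => x + t • y) y t := by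
      simpa using ((hasDerivAt_id t).smul_const y).const_add x
    exact ((hu _).hasFDerivAt.comp_hasDerivAt t h).norm_sq
  have hc : ConvexOn ℝ Set.univ fun t : ℝ => ‖u (x + t • y)‖ ^ 2 := by
    have := hconv.comp_affineMap (AffineMap.lineMap x (x + y))
    simpa [Function.comp_def, AffineMap.lineMap_apply, add_comm] using this
  intro s t hst
  have := hc.monotoneOn_deriv (fun t _ => (hd t).differentiableAt)
    (Set.mem_univ s) (Set.mem_univ t) hst
  rw [(hd s).deriv, (hd t).deriv] at this
  dsimp only
  linarith

end InnerFDeriv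

open MeasureTheory in
/-- Green's identity for a harmonic map against a compactly supported radial weight. -/
theorem mul_integral_radial_weight_mul_energy {n m : ℕ}
    {u : EuclideanSpace ℝ (Fin n) → EuclideanSpace ℝ (Fin m)} (hu : ContDiff ℝ 2 u)
    (hharm : ∀ x, ∑ i : Fin n, iteratedFDeriv ℝ 2 u x
      ![EuclideanSpace.single i (1 : ℝ), EuclideanSpace.single i (1 : ℝ)] = 0)
    (x : EuclideanSpace ℝ (Fin n)) {ψ : ℝ → ℝ} (hψ : ContDiff ℝ 1 ψ)
    (hψ1 : ∀ t, 1 ≤ t → ψ t = 0) (r : ℝ) :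
    r * ∫ y, ψ (‖y‖ ^ 2) *
        ∑ i : Fin n, ‖fderiv ℝ u (x + r • y) (EuclideanSpace.single i (1 : ℝ))‖ ^ 2 =
      ∫ y, -(2 * deriv ψ (‖y‖ ^ 2)) * inner ℝ (u (x + r • y)) (fderiv ℝ u (x + r • y) y) := by
  set η : EuclideanSpace ℝ (Fin n) → ℝ := fun y => ψ (‖y‖ ^ 2)
  have hηC : ContDiff ℝ 1 η := hψ.comp (contDiff_norm_sq ℝ)
  have hηs : HasCompactSupport η := by
    refine HasCompactSupport.of_support_subset_isCompact (isCompact_closedBall 0 1) ?_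
    intro y hy
    by_contra hy'
    refine hy (hψ1 _ ?_)
    simp only [Metric.mem_closedBall, dist_zero_right, not_le] at hy'
    nlinarith
  have hη' (y v) : fderiv ℝ η y v = deriv ψ (‖y‖ ^ 2) * (2 * inner ℝ y v) := by
    have h1 : HasFDerivAt η _ y := ((hψ.differentiable one_ne_zero) (‖y‖ ^ 2)).hasDerivAt.comp_hasFDerivAt y
      (hasStrictFDerivAt_norm_sq y).hasFDerivAt
    rw [h1.fderiv]
    simp
  set G : Fin n → EuclideanSpace ℝ (Fin n) → ℝ := fun i y =>
    inner ℝ (u (x + r • y)) (fderiv ℝ u (x + r • y) (EuclideanSpace.single i (1 : ℝ))) with hG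
  have hGC (i) : ContDiff ℝ 1 (G i) :=
    (contDiff_inner_fderiv_apply hu _).comp (by fun_prop)
  have hG' (i y) : fderiv ℝ (G i) y (EuclideanSpace.single i 1) =
      r * (‖fderiv ℝ u (x + r • y) (EuclideanSpace.single i (1 : ℝ))‖ ^ 2 +
        inner ℝ (u (x + r • y)) (iteratedFDeriv ℝ 2 u (x + r • y)
          ![EuclideanSpace.single i (1 : ℝ), EuclideanSpace.single i (1 : ℝ)])) := by
    rw [← fderiv_inner_fderiv_apply hu]
    exact fderiv_comp_const_add_smul
      ((contDiff_inner_fderiv_apply hu _).differentiable one_ne_zero) x y _ r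
  have hcG (i) : Continuous fun y => fderiv ℝ (G i) y (EuclideanSpace.single i 1) :=
    ((hGC i).continuous_fderiv one_ne_zero).clm_apply continuous_const
  have hcη (i : Fin n) : Continuous fun y => fderiv ℝ η y (EuclideanSpace.single i 1) :=
    (hηC.continuous_fderiv one_ne_zero).clm_apply continuous_const
  have hsη (i : Fin n) : HasCompactSupport fun y => fderiv ℝ η y (EuclideanSpace.single i 1) :=
    hηs.fderiv_apply (𝕜 := ℝ) _
  have hI1 (i) : Integrable fun y => η y * fderiv ℝ (G i) y (EuclideanSpace.single i 1) :=
    (hηC.continuous.mul (hcG i)).integrable_of_hasCompactSupport hηs.mul_right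
  have hI2 (i) : Integrable fun y => fderiv ℝ η y (EuclideanSpace.single i 1) * G i y :=
    ((hcη i).mul (hGC i).continuous).integrable_of_hasCompactSupport (hsη i).mul_right
  have hI3 (i) : Integrable fun y => η y * G i y :=
    (hηC.continuous.mul (hGC i).continuous).integrable_of_hasCompactSupport hηs.mul_right
  have key : ∑ i, ∫ y, η y * fderiv ℝ (G i) y (EuclideanSpace.single i 1) =
      ∑ i, -∫ y, fderiv ℝ η y (EuclideanSpace.single i 1) * G i y :=
    Finset.sum_congr rfl fun i _ => integral_mul_fderiv_eq_neg_fderiv_mul_of_integrable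
      (hI2 i) (hI1 i) (hI3 i) (fun y _ => hηC.differentiable one_ne_zero y)
      (fun y _ => (hGC i).differentiable one_ne_zero y)
  rw [← integral_finsetSum _ fun i _ => hI1 i, Finset.sum_neg_distrib,
    ← integral_finsetSum _ fun i _ => hI2 i] at key
  rw [← integral_const_mul]
  convert key using 1
  · refine integral_congr_ae (ae_of_all _ fun y => ?_)
    simp only [hG', ← Finset.mul_sum, Finset.sum_add_distrib, ← inner_sum, hharm,
      inner_zero_right, add_zero]
    ring
  · rw [← integral_neg]
    refine integral_congr_ae (ae_of_all _ fun y => ?_)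
    have hy : inner ℝ (u (x + r • y)) (fderiv ℝ u (x + r • y) y) = ∑ i, y i * G i y := by
      have hsum := congrArg (fderiv ℝ u (x + r • y))
        ((EuclideanSpace.basisFun (Fin n) ℝ).sum_repr y)
      simp only [map_sum, map_smul, EuclideanSpace.basisFun_repr,
        EuclideanSpace.basisFun_apply] at hsum
      rw [← hsum, inner_sum]
      simp only [inner_smul_right, hG]
    simp only [hη', hy, Finset.mul_sum, ← Finset.sum_neg_distrib]
    refine Finset.sum_congr rfl fun i _ => ?_
    rw [EuclideanSpace.inner_single_right]
    simp only [conj_trivial, one_mul]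
    ring

open MeasureTheory in
theorem monotone_mul_integral_radial_weight_mul_energy {n m : ℕ}
    {u : EuclideanSpace ℝ (Fin n) → EuclideanSpace ℝ (Fin m)} (hu : ContDiff ℝ 2 u)
    (hharm : ∀ x, ∑ i : Fin n, iteratedFDeriv ℝ 2 u x
      ![EuclideanSpace.single i (1 : ℝ), EuclideanSpace.single i (1 : ℝ)] = 0)
    (hconv : ConvexOn ℝ Set.univ (fun x => ‖u x‖ ^ 2))
    (x : EuclideanSpace ℝ (Fin n)) {ψ : ℝ → ℝ} (hψ : ContDiff ℝ 1 ψ)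
    (hψ1 : ∀ t, 1 ≤ t → ψ t = 0) (hanti : Antitone ψ) :
    Monotone fun r : ℝ => r * ∫ y, ψ (‖y‖ ^ 2) *
      ∑ i : Fin n, ‖fderiv ℝ u (x + r • y) (EuclideanSpace.single i (1 : ℝ))‖ ^ 2 := by
  have hint (r : ℝ) : Integrable fun y => -(2 * deriv ψ (‖y‖ ^ 2)) *
      inner ℝ (u (x + r • y)) (fderiv ℝ u (x + r • y) y) := by
    have hc : Continuous fun y => fderiv ℝ u (x + r • y) y :=
      ((hu.continuous_fderiv two_ne_zero).comp (by fun_prop)).clm_apply continuous_id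
    have hc' : Continuous (deriv ψ) := hψ.continuous_deriv le_rfl
    have hc'' := hu.continuous
    refine Continuous.integrable_of_hasCompactSupport (by fun_prop) ?_
    refine HasCompactSupport.of_support_subset_isCompact (isCompact_closedBall 0 1) ?_
    intro y hy
    by_contra hy'
    simp only [Metric.mem_closedBall, dist_zero_right, not_le] at hy'
    have h0 : ψ =ᶠ[nhds (‖y‖ ^ 2)] fun _ => 0 := by
      filter_upwards [Ioi_mem_nhds (show 1 < ‖y‖ ^ 2 by nlinarith)] with t ht
      exact hψ1 t (le_of_lt ht)
    exact hy (by simp [h0.deriv_eq])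
  intro r s hrs
  dsimp only
  rw [mul_integral_radial_weight_mul_energy hu hharm x hψ hψ1,
    mul_integral_radial_weight_mul_energy hu hharm x hψ hψ1]
  refine integral_mono (hint r) (hint s) fun y => mul_le_mul_of_nonneg_left
    (monotone_inner_fderiv_ray (hu.differentiable two_ne_zero) hconv x y hrs) ?_
  have := hanti.deriv_nonpos (x := ‖y‖ ^ 2)
  linarith

open MeasureTheory Filter Topology in
/-- Smooth radial cutoffs increase to the indicator of the unit ball. -/
theorem tendsto_integral_smoothTransition_mul {E : Type*} [NormedAddCommGroup E]
    [MeasurableSpace E] [BorelSpace E] [ProperSpace E] {μ : Measure E}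
    [IsFiniteMeasureOnCompacts μ] {e : E → ℝ} (he : Continuous e) :
    Tendsto (fun k : ℕ => ∫ y, Real.smoothTransition (k * (1 - ‖y‖ ^ 2)) * e y ∂μ) atTop
      (𝓝 (∫ y in Metric.ball 0 1, e y ∂μ)) := by
  rw [← integral_indicator measurableSet_ball]
  have hint : IntegrableOn (fun y => ‖e y‖) (Metric.ball 0 1) μ :=
    (he.norm.continuousOn.integrableOn_compact (isCompact_closedBall 0 1)).mono_set
      Metric.ball_subset_closedBall
  have hout {k : ℕ} {y : E} (hy : y ∉ Metric.ball (0 : E) 1) :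
      Real.smoothTransition (k * (1 - ‖y‖ ^ 2)) = 0 := by
    refine Real.smoothTransition.zero_of_nonpos (mul_nonpos_of_nonneg_of_nonpos k.cast_nonneg ?_)
    simp only [Metric.mem_ball, dist_zero_right, not_lt] at hy
    nlinarith
  refine tendsto_integral_of_dominated_convergence
    ((Metric.ball 0 1).indicator fun y => ‖e y‖) (fun k => ?_)
    (hint.integrable_indicator measurableSet_ball) (fun k => ae_of_all _ fun y => ?_)
    (ae_of_all _ fun y => ?_)
  · have := Real.smoothTransition.continuous
    exact Continuous.aestronglyMeasurable (by fun_prop)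
  · by_cases hy : y ∈ Metric.ball (0 : E) 1
    · rw [Set.indicator_of_mem hy, norm_mul, Real.norm_of_nonneg (Real.smoothTransition.nonneg _)]
      exact mul_le_of_le_one_left (norm_nonneg _) (Real.smoothTransition.le_one _)
    · simp [hout hy, hy]
  · by_cases hy : y ∈ Metric.ball (0 : E) 1
    · rw [Set.indicator_of_mem hy]
      have hpos : 0 < 1 - ‖y‖ ^ 2 := by
        simp only [Metric.mem_ball, dist_zero_right] at hy
        nlinarith [norm_nonneg y]
      refine tendsto_const_nhds.congr' ?_
      filter_upwards [(tendsto_natCast_atTop_atTop.atTop_mul_const hpos).eventually_ge_atTop 1]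
        with k hk
      rw [Real.smoothTransition.one_of_one_le hk, one_mul]
    · simp [hout hy, hy]


/-- Let `u : ℝⁿ → ℝ^m` be a harmonic map such that `|u|²` is convex. Then
`r ↦ (1/r^{n−1}) ∫_{B(x,r)} |∇u|² dy` is nondecreasing in `r > 0`. -/
theorem harmonic_energy_monotone (n m : ℕ)
    (u : EuclideanSpace ℝ (Fin n) → EuclideanSpace ℝ (Fin m))
    (hu : ContDiff ℝ 2 u)
    (hharm : ∀ x, ∑ i : Fin n, iteratedFDeriv ℝ 2 u x
      ![EuclideanSpace.single i (1 : ℝ), EuclideanSpace.single i (1 : ℝ)] = 0)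
    (hconv : ConvexOn ℝ Set.univ (fun x => ‖u x‖ ^ 2))
    (x : EuclideanSpace ℝ (Fin n)) :
    ∀ r₁ r₂ : ℝ, 0 < r₁ → r₁ ≤ r₂ →
      (1 / r₁ ^ (n - 1)) * ∫ y in Metric.ball x r₁,
          ∑ i : Fin n, ‖fderiv ℝ u y (EuclideanSpace.single i (1 : ℝ))‖ ^ 2 ≤
        (1 / r₂ ^ (n - 1)) * ∫ y in Metric.ball x r₂,
          ∑ i : Fin n, ‖fderiv ℝ u y (EuclideanSpace.single i (1 : ℝ))‖ ^ 2 := by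
  intro r₁ r₂ hr₁ hr
  rcases eq_or_ne n 0 with rfl | hn
  · simp
  rw [one_div_pow_mul_setIntegral_ball hn _ x hr₁,
    one_div_pow_mul_setIntegral_ball hn _ x (hr₁.trans_le hr)]
  have hlim (r : ℝ) := (tendsto_integral_smoothTransition_mul (μ := MeasureTheory.volume)
    (e := fun y => ∑ i : Fin n,
      ‖fderiv ℝ u (x + r • y) (EuclideanSpace.single i (1 : ℝ))‖ ^ 2) (by
        have := hu.continuous_fderiv two_ne_zero
        fun_prop)).const_mul r
  refine le_of_tendsto_of_tendsto' (hlim r₁) (hlim r₂) fun k => ?_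
  refine monotone_mul_integral_radial_weight_mul_energy hu hharm hconv x
    (ψ := fun t => Real.smoothTransition (k * (1 - t)))
    (Real.smoothTransition.contDiff.comp (by fun_prop)) (fun t ht => ?_) (fun s t hst => ?_) hr
  · exact Real.smoothTransition.zero_of_nonpos
      (mul_nonpos_of_nonneg_of_nonpos k.cast_nonneg (by linarith))
  · exact Real.smoothTransition.monotone (by gcongr)
end

section
/- Let W : ℝ^m → ℝ be C², nonnegative, and let u ∈ C²(ℝ², ℝ^m) solve Δu = ∇W(u) and satisfy (|u_{x₁}|² − |u_{x₂}|²)² + 4(u_{x₁}·u_{x₂})² ≤ 4W(u)² everywhere. Then for every x ∈ ℝ², r ↦ (1/r)∫_{B(x,r)} W(u(y)) dy is nondecreasing in r > 0. -/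
open scoped RealInnerProductSpace

/-- The `i`-th standard basis vector of `ℝ²`. -/
noncomputable def e2 (i : Fin 2) : EuclideanSpace ℝ (Fin 2) :=
  EuclideanSpace.single i (1 : ℝ)

open MeasureTheory Set Real

/-- The point of the plane with polar coordinates `q = (r, θ)` around `x`. -/
noncomputable def polarPoint (x : EuclideanSpace ℝ (Fin 2)) (q : ℝ × ℝ) :
    EuclideanSpace ℝ (Fin 2) :=
  x + ((q.1 * cos q.2) • e2 0 + (q.1 * sin q.2) • e2 1)

theorem contDiff_polarPoint (x : EuclideanSpace ℝ (Fin 2)) {n : WithTop ℕ∞} :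
    ContDiff ℝ n (polarPoint x) := by
  unfold polarPoint
  fun_prop

theorem continuous_polarPoint (x : EuclideanSpace ℝ (Fin 2)) : Continuous (polarPoint x) :=
  (contDiff_polarPoint x (n := 0)).continuous

theorem polarPoint_pi (x : EuclideanSpace ℝ (Fin 2)) (r : ℝ) :
    polarPoint x (r, π) = polarPoint x (r, -π) := by
  simp [polarPoint]

theorem hasDerivAt_polarPoint_radial (x : EuclideanSpace ℝ (Fin 2)) (r θ : ℝ) :
    HasDerivAt (fun t => polarPoint x (t, θ)) (cos θ • e2 0 + sin θ • e2 1) r := by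
  unfold polarPoint
  refine HasDerivAt.const_add x (HasDerivAt.add ?_ ?_)
  · simpa using ((hasDerivAt_id r).mul_const (cos θ)).smul_const (e2 0)
  · simpa using ((hasDerivAt_id r).mul_const (sin θ)).smul_const (e2 1)

theorem hasDerivAt_polarPoint_angular (x : EuclideanSpace ℝ (Fin 2)) (r θ : ℝ) :
    HasDerivAt (fun t => polarPoint x (r, t))
      ((r * -sin θ) • e2 0 + (r * cos θ) • e2 1) θ := by
  unfold polarPoint
  exact HasDerivAt.const_add x <|
    (((hasDerivAt_cos θ).const_mul r).smul_const (e2 0)).add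
      (((hasDerivAt_sin θ).const_mul r).smul_const (e2 1))

theorem hasDerivAt_comp_polarPoint_radial {A : EuclideanSpace ℝ (Fin 2) → ℝ}
    (hA : ContDiff ℝ 1 A) (x : EuclideanSpace ℝ (Fin 2)) (r θ : ℝ) :
    HasDerivAt (fun t => A (polarPoint x (t, θ)))
      (cos θ * fderiv ℝ A (polarPoint x (r, θ)) (e2 0) +
        sin θ * fderiv ℝ A (polarPoint x (r, θ)) (e2 1)) r := by
  have h := ((hA.differentiable one_ne_zero) (polarPoint x (r, θ))).hasFDerivAt.comp_hasDerivAt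
    r (hasDerivAt_polarPoint_radial x r θ)
  exact h.congr_deriv (by simp)

theorem hasDerivAt_comp_polarPoint_angular {A : EuclideanSpace ℝ (Fin 2) → ℝ}
    (hA : ContDiff ℝ 1 A) (x : EuclideanSpace ℝ (Fin 2)) (r θ : ℝ) :
    HasDerivAt (fun t => A (polarPoint x (r, t)))
      (r * (-sin θ * fderiv ℝ A (polarPoint x (r, θ)) (e2 0) +
        cos θ * fderiv ℝ A (polarPoint x (r, θ)) (e2 1))) θ := by
  have h := ((hA.differentiable one_ne_zero) (polarPoint x (r, θ))).hasFDerivAt.comp_hasDerivAt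
    θ (hasDerivAt_polarPoint_angular x r θ)
  refine h.congr_deriv ?_
  simp only [map_add, map_smul, smul_eq_mul]
  ring

/-- The divergence theorem on a disk centred at `x`, in polar coordinates, for the vector field
`y ↦ A(y) (y - x)`, where `A = [[A₁₁, A₁₂], [A₁₂, A₂₂]]` is a divergence-free symmetric matrix
field. -/
theorem integral_trace_eq_boundary {A₁₁ A₁₂ A₂₂ : EuclideanSpace ℝ (Fin 2) → ℝ}
    (h₁₁ : ContDiff ℝ 1 A₁₁) (h₁₂ : ContDiff ℝ 1 A₁₂) (h₂₂ : ContDiff ℝ 1 A₂₂)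
    (hdiv₁ : ∀ y, fderiv ℝ A₁₁ y (e2 0) + fderiv ℝ A₁₂ y (e2 1) = 0)
    (hdiv₂ : ∀ y, fderiv ℝ A₁₂ y (e2 0) + fderiv ℝ A₂₂ y (e2 1) = 0)
    (x : EuclideanSpace ℝ (Fin 2)) (R : ℝ) :
    ∫ r in (0 : ℝ)..R, ∫ θ in -π..π,
        r * (A₁₁ (polarPoint x (r, θ)) + A₂₂ (polarPoint x (r, θ))) =
      ∫ θ in -π..π, R ^ 2 * (cos θ ^ 2 * A₁₁ (polarPoint x (R, θ)) +
        2 * (cos θ * sin θ) * A₁₂ (polarPoint x (R, θ)) +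
        sin θ ^ 2 * A₂₂ (polarPoint x (R, θ))) := by
  set p := polarPoint x with hp
  have hpc : ContDiff ℝ 1 p := contDiff_polarPoint x
  have c₁₁ := h₁₁.comp hpc
  have c₁₂ := h₁₂.comp hpc
  have c₂₂ := h₂₂.comp hpc
  let f : ℝ × ℝ → ℝ := fun q => q.1 ^ 2 * (cos q.2 ^ 2 * (A₁₁ ∘ p) q +
    2 * (cos q.2 * sin q.2) * (A₁₂ ∘ p) q + sin q.2 ^ 2 * (A₂₂ ∘ p) q)
  let g : ℝ × ℝ → ℝ := fun q => q.1 * ((cos q.2 * sin q.2) * ((A₂₂ ∘ p) q - (A₁₁ ∘ p) q) +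
    (cos q.2 ^ 2 - sin q.2 ^ 2) * (A₁₂ ∘ p) q)
  have hf : ContDiff ℝ 1 f := by fun_prop
  have hg : ContDiff ℝ 1 g := by fun_prop
  have hfd := hf.differentiable one_ne_zero
  have hgd := hg.differentiable one_ne_zero
  have key : ∀ q : ℝ × ℝ, fderiv ℝ f q (1, 0) + fderiv ℝ g q (0, 1) =
      q.1 * (A₁₁ (p q) + A₂₂ (p q)) := by
    rintro ⟨r, θ⟩
    have hf₁ : HasDerivAt (fun t => f (t, θ)) (fderiv ℝ f (r, θ) (1, 0)) r :=
      HasFDerivAt.comp_hasDerivAt (f := fun t => (t, θ)) r (hfd (r, θ)).hasFDerivAt ((hasDerivAt_id r).prodMk (hasDerivAt_const r θ))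
    have hg₁ : HasDerivAt (fun t => g (r, t)) (fderiv ℝ g (r, θ) (0, 1)) θ :=
      HasFDerivAt.comp_hasDerivAt (f := fun t => (r, t)) θ (hgd (r, θ)).hasFDerivAt ((hasDerivAt_const θ r).prodMk (hasDerivAt_id θ))
    have hf₂ := ((hasDerivAt_id r).pow 2).mul
      ((((hasDerivAt_comp_polarPoint_radial h₁₁ x r θ).const_mul (cos θ ^ 2)).add
        ((hasDerivAt_comp_polarPoint_radial h₁₂ x r θ).const_mul (2 * (cos θ * sin θ)))).add
        ((hasDerivAt_comp_polarPoint_radial h₂₂ x r θ).const_mul (sin θ ^ 2)))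
    have hg₂ := (((((hasDerivAt_cos θ).mul (hasDerivAt_sin θ)).mul
      ((hasDerivAt_comp_polarPoint_angular h₂₂ x r θ).sub
        (hasDerivAt_comp_polarPoint_angular h₁₁ x r θ))).add
      ((((hasDerivAt_cos θ).pow 2).sub ((hasDerivAt_sin θ).pow 2)).mul
        (hasDerivAt_comp_polarPoint_angular h₁₂ x r θ)))).const_mul r
    rw [hf₁.unique hf₂, hg₁.unique hg₂]
    simp only [← hp, id, Pi.add_apply, Pi.sub_apply, Pi.mul_apply, Pi.pow_apply]
    have hd₁ := hdiv₁ (p (r, θ))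
    have hd₂ := hdiv₂ (p (r, θ))
    have hcs := sin_sq_add_cos_sq θ
    push_cast
    set c := cos θ
    set s := sin θ
    linear_combination (r ^ 2 * (c * (fderiv ℝ A₁₁ (p (r, θ)) (e2 0) +
      fderiv ℝ A₁₂ (p (r, θ)) (e2 1)) + s * (fderiv ℝ A₁₂ (p (r, θ)) (e2 0) +
      fderiv ℝ A₂₂ (p (r, θ)) (e2 1))) + r * (A₁₁ (p (r, θ)) + A₂₂ (p (r, θ)))) * hcs +
      r ^ 2 * c * hd₁ + r ^ 2 * s * hd₂
  have hcont : Continuous fun q => fderiv ℝ f q (1, 0) + fderiv ℝ g q (0, 1) := by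
    have := h₁₁.continuous
    have := h₂₂.continuous
    have := hpc.continuous
    simp only [key]
    fun_prop
  have h := integral2_divergence_prod_of_hasFDerivAt_off_countable f g (fderiv ℝ f) (fderiv ℝ g)
    0 (-π) R π ∅ countable_empty hf.continuous.continuousOn hg.continuous.continuousOn
    (fun q _ => (hfd q).hasFDerivAt) (fun q _ => (hgd q).hasFDerivAt)
    (hcont.continuousOn.integrableOn_compact (isCompact_uIcc.prod isCompact_uIcc))
  simp only [key] at h
  rw [h]
  have hg_eq : ∀ r, g (r, π) = g (r, -π) := fun r => by
    simp [g, hp, polarPoint_pi]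
  simp [hg_eq, f]

/-- Polar coordinates for the integral over a disk. -/
theorem setIntegral_ball_eq_polar {w : EuclideanSpace ℝ (Fin 2) → ℝ} (hw : Continuous w)
    (x : EuclideanSpace ℝ (Fin 2)) {R : ℝ} (hR : 0 < R) :
    ∫ y in Metric.ball x R, w y =
      ∫ r in (0 : ℝ)..R, ∫ θ in -π..π, r * w (polarPoint x (r, θ)) := by
  have hmp : MeasurePreserving (fun q : ℝ × ℝ => x + (q.1 • e2 0 + q.2 • e2 1)) := by
    have h₁ := (PiLp.volume_preserving_toLp (Fin 2)).comp (volume_preserving_finTwoArrow ℝ).symm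
    have h₂ : (fun q : ℝ × ℝ => x + (q.1 • e2 0 + q.2 • e2 1)) =
        (x + ·) ∘ (WithLp.toLp 2 ∘ MeasurableEquiv.finTwoArrow.symm) := by
      ext q i
      fin_cases i <;> simp [e2]
    rw [h₂]
    exact (measurePreserving_add_left volume x).comp h₁
  have hme : MeasurableEmbedding (fun q : ℝ × ℝ => x + (q.1 • e2 0 + q.2 • e2 1)) := by
    refine Continuous.measurableEmbedding (by fun_prop) fun q q' h => ?_
    have h0 := congrArg (fun z : EuclideanSpace ℝ (Fin 2) => z 0) h
    have h1 := congrArg (fun z : EuclideanSpace ℝ (Fin 2) => z 1) h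
    simp [e2] at h0 h1
    exact Prod.ext h0 h1
  have hball : ∀ q : ℝ × ℝ, 0 < q.1 → (polarPoint x q ∈ Metric.ball x R ↔ q.1 < R) := by
    intro q hq
    have : dist (polarPoint x q) x = q.1 := by
      rw [dist_eq_norm, EuclideanSpace.norm_eq, ← sqrt_sq hq.le]
      congr 1
      simp [polarPoint, e2, Fin.sum_univ_two]
      linear_combination q.1 ^ 2 * sin_sq_add_cos_sq q.2
    rw [Metric.mem_ball, this]
  have hcont : Continuous fun q : ℝ × ℝ => q.1 * w (polarPoint x q) := by
    have := continuous_polarPoint x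
    fun_prop
  calc ∫ y in Metric.ball x R, w y
      = ∫ q in polarCoord.target, q.1 * (Metric.ball x R).indicator w (polarPoint x q) := by
        rw [← integral_indicator measurableSet_ball, ← hmp.integral_comp hme,
          ← integral_comp_polarCoord_symm]
        simp [polarPoint]
    _ = ∫ q in polarCoord.target,
          (Iio R ×ˢ univ).indicator (fun q : ℝ × ℝ => q.1 * w (polarPoint x q)) q := by
        refine setIntegral_congr_fun polarCoord.open_target.measurableSet fun q hq => ?_
        have := hball q hq.1
        by_cases h : q.1 < R
        · simp [indicator, this, h]
        · simp [indicator, this, h]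
    _ = ∫ q in Ioo 0 R ×ˢ Ioo (-π) π, q.1 * w (polarPoint x q) := by
        rw [setIntegral_indicator (measurableSet_Iio.prod MeasurableSet.univ), polarCoord_target,
          prod_inter_prod, Ioi_inter_Iio, inter_univ]
    _ = ∫ r in (0 : ℝ)..R, ∫ θ in -π..π, r * w (polarPoint x (r, θ)) := by
        rw [Measure.volume_eq_prod, setIntegral_prod]
        · simp only [intervalIntegral.integral_of_le hR.le,
            intervalIntegral.integral_of_le (neg_le_self pi_pos.le), integral_Ioc_eq_integral_Ioo]
        · exact (hcont.continuousOn.integrableOn_compact (isCompact_Icc.prod isCompact_Icc)).mono_set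
            (prod_mono Ioo_subset_Icc_self Ioo_subset_Icc_self)

/-- If `F` is the primitive of `h` with `F r ≤ r * h r`, then `F r / r` is nondecreasing. -/
theorem monotoneOn_primitive_div {h : ℝ → ℝ} (hh : Continuous h)
    (hle : ∀ r, 0 < r → ∫ t in (0 : ℝ)..r, h t ≤ r * h r) :
    MonotoneOn (fun r => 1 / r * ∫ t in (0 : ℝ)..r, h t) (Ioi 0) := by
  have hd : ∀ r ∈ Ioi (0 : ℝ), HasDerivAt (fun r => 1 / r * ∫ t in (0 : ℝ)..r, h t)
      (-(r ^ 2)⁻¹ * (∫ t in (0 : ℝ)..r, h t) + 1 / r * h r) r := by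
    intro r hr
    have := (hasDerivAt_inv (ne_of_gt hr)).mul (hh.integral_hasStrictDerivAt 0 r).hasDerivAt
    simp only [one_div]
    exact this
  refine monotoneOn_of_deriv_nonneg (convex_Ioi 0)
    (fun r hr => (hd r hr).continuousAt.continuousWithinAt) ?_ ?_ <;> rw [interior_Ioi]
  · exact fun r hr => (hd r hr).differentiableAt.differentiableWithinAt
  · intro r hr
    rw [(hd r hr).deriv]
    have hr' : 0 < r := hr
    have : -(r ^ 2)⁻¹ * (∫ t in (0 : ℝ)..r, h t) + 1 / r * h r =
        (r ^ 2)⁻¹ * (r * h r - ∫ t in (0 : ℝ)..r, h t) := by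
      field_simp
      ring
    rw [this]
    exact mul_nonneg (by positivity) (sub_nonneg.2 (hle r hr))

/-- The quadratic form of the trace-free matrix `[[a, b], [b, -a]]` on unit vectors is bounded
by `w` when `a² + b² ≤ w²`. -/
theorem tracefree_form_le {a b c s w : ℝ} (hcs : s ^ 2 + c ^ 2 = 1) (hw : 0 ≤ w)
    (h : a ^ 2 + b ^ 2 ≤ w ^ 2) : (c ^ 2 - s ^ 2) * a + 2 * (c * s) * b ≤ w := by
  refine le_of_sq_le_sq ?_ hw
  have h1 : (c ^ 2 - s ^ 2) ^ 2 + (2 * (c * s)) ^ 2 = 1 := by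
    linear_combination (s ^ 2 + c ^ 2 + 1) * hcs
  nlinarith [sq_nonneg ((c ^ 2 - s ^ 2) * b - 2 * (c * s) * a)]

theorem hasFDerivAt_fderiv_apply {m : ℕ} {u : EuclideanSpace ℝ (Fin 2) → EuclideanSpace ℝ (Fin m)}
    (hu : ContDiff ℝ 2 u) (v y : EuclideanSpace ℝ (Fin 2)) :
    HasFDerivAt (fun z => fderiv ℝ u z v)
      ((ContinuousLinearMap.apply ℝ _ v).comp (fderiv ℝ (fderiv ℝ u) y)) y :=
  (ContinuousLinearMap.apply ℝ (EuclideanSpace ℝ (Fin m)) v).hasFDerivAt.comp y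
    ((hu.fderiv_right (m := 1) le_rfl).differentiable one_ne_zero y).hasFDerivAt

/-- Let `W : ℝ^m → ℝ` be `C²` nonnegative, and `u ∈ C²(ℝ², ℝ^m)` solve
`Δu = ∇W(u)` and satisfy `(|u_{x₁}|² − |u_{x₂}|²)² + 4(u_{x₁}·u_{x₂})² ≤ 4W(u)²`
everywhere. Then for every `x ∈ ℝ²`, `r ↦ (1/r)∫_{B(x,r)} W(u(y)) dy` is nondecreasing
in `r > 0`. -/
theorem strong_monotonicity_formula (m : ℕ)
    (W : EuclideanSpace ℝ (Fin m) → ℝ) (hW : ContDiff ℝ 2 W) (hWnonneg : ∀ v, 0 ≤ W v)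
    (u : EuclideanSpace ℝ (Fin 2) → EuclideanSpace ℝ (Fin m)) (hu : ContDiff ℝ 2 u)
    (hsol : ∀ x, ∑ i : Fin 2, iteratedFDeriv ℝ 2 u x ![e2 i, e2 i] = gradient W (u x))
    (hineq : ∀ x,
      (‖fderiv ℝ u x (e2 0)‖ ^ 2 - ‖fderiv ℝ u x (e2 1)‖ ^ 2) ^ 2 +
          4 * ⟪fderiv ℝ u x (e2 0), fderiv ℝ u x (e2 1)⟫ ^ 2 ≤ 4 * (W (u x)) ^ 2)
    (x : EuclideanSpace ℝ (Fin 2)) :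
    ∀ r₁ r₂ : ℝ, 0 < r₁ → r₁ ≤ r₂ →
      (1 / r₁) * ∫ y in Metric.ball x r₁, W (u y) ≤
        (1 / r₂) * ∫ y in Metric.ball x r₂, W (u y) := by
  set a := fun y => fderiv ℝ u y (e2 0) with ha
  set b := fun y => fderiv ℝ u y (e2 1) with hb
  have hDu : ContDiff ℝ 1 (fderiv ℝ u) := hu.fderiv_right le_rfl
  have hac : ContDiff ℝ 1 a := hDu.clm_apply contDiff_const
  have hbc : ContDiff ℝ 1 b := hDu.clm_apply contDiff_const
  have hwc : ContDiff ℝ 1 (fun y => W (u y)) := (hW.comp hu).of_le one_le_two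
  have hwcont : Continuous fun y => W (u y) := hwc.continuous
  have had := fun y => hasFDerivAt_fderiv_apply hu (e2 0) y
  have hbd := fun y => hasFDerivAt_fderiv_apply hu (e2 1) y
  have hwd : ∀ y, HasFDerivAt (fun y => W (u y)) ((fderiv ℝ W (u y)).comp (fderiv ℝ u y)) y :=
    fun y => (hW.differentiable two_ne_zero (u y)).hasFDerivAt.comp y
      (hu.differentiable two_ne_zero y).hasFDerivAt
  have hsymm : ∀ y, fderiv ℝ (fderiv ℝ u) y (e2 0) (e2 1) = fderiv ℝ (fderiv ℝ u) y (e2 1) (e2 0) :=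
    fun y => (hu.contDiffAt.isSymmSndFDerivAt (by simp)) _ _
  have hpde : ∀ y v, fderiv ℝ W (u y) v =
      ⟪fderiv ℝ (fderiv ℝ u) y (e2 0) (e2 0), v⟫ + ⟪fderiv ℝ (fderiv ℝ u) y (e2 1) (e2 1), v⟫ := by
    intro y v
    rw [← inner_gradient_left, ← hsol, ← inner_add_left]
    simp [Fin.sum_univ_two, iteratedFDeriv_two_apply]
  have hdc : ContDiff ℝ 1 fun y => 1 / 2 * (‖b y‖ ^ 2 - ‖a y‖ ^ 2) :=
    contDiff_const.mul ((hbc.norm_sq ℝ).sub (hac.norm_sq ℝ))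
  have hdd : ∀ y, HasFDerivAt (fun y => 1 / 2 * (‖b y‖ ^ 2 - ‖a y‖ ^ 2)) _ y := fun y =>
    ((hbd y).norm_sq.sub (had y).norm_sq).const_mul (1 / 2)
  have hA₁₁ : ∀ y, HasFDerivAt (fun y => W (u y) + 1 / 2 * (‖b y‖ ^ 2 - ‖a y‖ ^ 2)) _ y :=
    fun y => (hwd y).add (hdd y)
  have hA₂₂ : ∀ y, HasFDerivAt (fun y => W (u y) - 1 / 2 * (‖b y‖ ^ 2 - ‖a y‖ ^ 2)) _ y :=
    fun y => (hwd y).sub (hdd y)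
  have hA₁₂ : ∀ y, HasFDerivAt (fun y => -⟪a y, b y⟫) _ y :=
    fun y => ((had y).inner ℝ (hbd y)).neg
  have hid := integral_trace_eq_boundary (hwc.add hdc) (hac.inner ℝ hbc).neg (hwc.sub hdc)
    (fun y => by
      rw [(hA₁₁ y).fderiv, (hA₁₂ y).fderiv]
      simp [hpde, hsymm, real_inner_comm]
      ring)
    (fun y => by
      rw [(hA₂₂ y).fderiv, (hA₁₂ y).fderiv]
      simp [hpde, hsymm, real_inner_comm]
      ring) x
  have hpc := continuous_polarPoint x
  have hint : Continuous fun r : ℝ => ∫ θ in -π..π, r * W (u (polarPoint x (r, θ))) :=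
    intervalIntegral.continuous_parametric_intervalIntegral_of_continuous' (by fun_prop) _ _
  have hmono := monotoneOn_primitive_div hint fun r hr => by
    have h2 : 2 * ∫ t in (0 : ℝ)..r, ∫ θ in -π..π, t * W (u (polarPoint x (t, θ))) ≤
        2 * (r * ∫ θ in -π..π, r * W (u (polarPoint x (r, θ)))) := by
      have hl : 2 * ∫ t in (0 : ℝ)..r, ∫ θ in -π..π, t * W (u (polarPoint x (t, θ))) = _ :=
        Eq.trans (by
          simp only [← intervalIntegral.integral_const_mul]
          refine intervalIntegral.integral_congr fun t _ =>
            intervalIntegral.integral_congr fun θ _ => ?_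
          ring) (hid r)
      rw [hl]
      simp only [← intervalIntegral.integral_const_mul]
      have hac' := hac.continuous
      have hbc' := hbc.continuous
      refine intervalIntegral.integral_mono_on (neg_le_self pi_pos.le)
        (Continuous.intervalIntegrable (by fun_prop) _ _)
        (Continuous.intervalIntegrable (by fun_prop) _ _) fun θ _ => ?_
      set y := polarPoint x (r, θ)
      have := tracefree_form_le (a := 1 / 2 * (‖b y‖ ^ 2 - ‖a y‖ ^ 2)) (b := -⟪a y, b y⟫)
        (sin_sq_add_cos_sq θ) (hWnonneg (u y)) (by linarith [hineq y])
      have hcs := sin_sq_add_cos_sq θ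
      calc _ = r ^ 2 * (((cos θ ^ 2 - sin θ ^ 2) * (1 / 2 * (‖b y‖ ^ 2 - ‖a y‖ ^ 2)) +
            2 * (cos θ * sin θ) * -⟪a y, b y⟫) + W (u y)) := by
            linear_combination r ^ 2 * W (u y) * hcs
        _ ≤ r ^ 2 * (W (u y) + W (u y)) := by gcongr
        _ = _ := by ring
    linarith
  intro r₁ r₂ hr₁ hr
  rw [setIntegral_ball_eq_polar hwcont x hr₁, setIntegral_ball_eq_polar hwcont x (hr₁.trans_le hr)]
  exact hmono hr₁ (hr₁.trans_le hr) hr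
end
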